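/- Consider the asymmetric heterogeneous HK model with trust sets I_i(x) = {j : −d + η_i ≤ x_j − x_i ≤ d}, where η_i ≥ 0 for all i and η = max_i η_i < d. Then for any initial opinions x(0) ∈ ℝ^n the dynamics terminates in finite time: there exists k* such that x(k) = x(k*) for all k ≥ k*. -/

import Mathlib

open Finset

/-- The agents of `S` trusted by agent `i` when the opinions are `y`. -/
noncomputable def trustSet {ι : Type*} (d : ℝ) (η : ι → ℝ) (S : Finset ι) (y : ι → ℝ) (i : ι) :
    Finset ι :=
  S.filter fun j => -d + η i ≤ y j - y i ∧ y j - y i ≤ d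

/-- The asymmetric HK dynamics restricted to the agents of `S`. -/
def IsHKTrajectory {ι : Type*} (d : ℝ) (η : ι → ℝ) (S : Finset ι) (x : ℕ → ι → ℝ) : Prop :=
  ∀ k, ∀ i ∈ S, x (k + 1) i =
    (∑ j ∈ trustSet d η S (x k) i, x k j) / ((trustSet d η S (x k) i).card : ℝ)

section Average

variable {ι : Type*} {T : Finset ι} {f : ι → ℝ} {a b : ℝ}

lemma le_average (hT : T.Nonempty) (h : ∀ j ∈ T, a ≤ f j) : a ≤ (∑ j ∈ T, f j) / (T.card : ℝ) := by
  rw [le_div_iff₀ (by exact_mod_cast hT.card_pos)]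
  have := card_nsmul_le_sum T f a h
  rw [nsmul_eq_mul] at this
  linarith

lemma average_le (hT : T.Nonempty) (h : ∀ j ∈ T, f j ≤ b) : (∑ j ∈ T, f j) / (T.card : ℝ) ≤ b := by
  rw [div_le_iff₀ (by exact_mod_cast hT.card_pos)]
  have := sum_le_card_nsmul T f b h
  rw [nsmul_eq_mul] at this
  linarith

/-- If all values are at least `a` and their average is at most `a + b`, then no value exceeds
`a + N * b`, where `N` bounds the number of values. -/
lemma le_of_average_le {N : ℕ} (hN : T.card ≤ N) (h : ∀ j ∈ T, a ≤ f j)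
    (hav : (∑ j ∈ T, f j) / (T.card : ℝ) ≤ a + b) {j : ι} (hj : j ∈ T) : f j ≤ a + N * b := by
  have hT : T.Nonempty := ⟨j, hj⟩
  have hb : 0 ≤ b := by linarith [le_average hT h]
  rw [div_le_iff₀ (by exact_mod_cast hT.card_pos)] at hav
  have h1 : f j - a ≤ ∑ i ∈ T, (f i - a) :=
    single_le_sum (f := fun i => f i - a) (fun i hi => sub_nonneg.2 (h i hi)) hj
  rw [sum_sub_distrib, sum_const, nsmul_eq_mul] at h1
  have h2 : (T.card : ℝ) * b ≤ N * b := by gcongr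
  linarith

end Average

section HK

variable {ι : Type*} {d : ℝ} {η : ι → ℝ} {S : Finset ι} {x : ℕ → ι → ℝ}

lemma mem_trustSet {y : ι → ℝ} {i j : ι} :
    j ∈ trustSet d η S y i ↔ j ∈ S ∧ -d + η i ≤ y j - y i ∧ y j - y i ≤ d :=
  mem_filter

lemma self_mem_trustSet {y : ι → ℝ} {i : ι} (hη0 : 0 ≤ η i) (hηd : η i < d) (hi : i ∈ S) :
    i ∈ trustSet d η S y i :=
  mem_trustSet.2 ⟨hi, by linarith, by linarith⟩

namespace IsHKTrajectory

lemma monotone_inf' (hx : IsHKTrajectory d η S x) (hη0 : ∀ i, 0 ≤ η i)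
    (hηd : ∀ i, η i < d) (hS : S.Nonempty) : Monotone fun k => S.inf' hS (x k) := by
  refine monotone_nat_of_le_succ fun k => (le_inf'_iff _ _).2 fun i hi => ?_
  rw [hx k i hi]
  exact le_average ⟨i, self_mem_trustSet (hη0 i) (hηd i) hi⟩
    fun j hj => inf'_le _ (mem_trustSet.1 hj).1

lemma le_sup'_zero (hx : IsHKTrajectory d η S x) (hη0 : ∀ i, 0 ≤ η i)
    (hηd : ∀ i, η i < d) (hS : S.Nonempty) (k : ℕ) : ∀ i ∈ S, x k i ≤ S.sup' hS (x 0) := by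
  induction k with
  | zero => exact fun i hi => le_sup' (x 0) hi
  | succ k ih =>
    intro i hi
    rw [hx k i hi]
    exact average_le ⟨i, self_mem_trustSet (hη0 i) (hηd i) hi⟩
      fun j hj => ih j (mem_trustSet.1 hj).1

/-- From some time on, a nonempty set `C` of agents of lowest opinion trusts exactly itself, and
all other agents are strictly above it. -/
lemma exists_isolated_cluster (hx : IsHKTrajectory d η S x) (hη0 : ∀ i, 0 ≤ η i)
    (hηd : ∀ i, η i < d) (hS : S.Nonempty) :
    ∃ C ⊆ S, C.Nonempty ∧ ∃ K, ∀ k, K ≤ k → ∀ i ∈ C,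
      trustSet d η S (x k) i = C ∧ ∀ j ∈ S, j ∉ C → x k i < x k j := by
  classical
  obtain ⟨i₁, hi₁, hmin⟩ := S.exists_min_image (fun i => d - η i) hS
  obtain ⟨δ, hδ⟩ : ∃ δ, δ = d - η i₁ := ⟨_, rfl⟩
  have hδ0 : 0 < δ := by linarith [hηd i₁]
  have hδd : δ ≤ d := by linarith [hη0 i₁]
  have hδη : ∀ i ∈ S, δ ≤ d - η i := fun i hi => hδ ▸ hmin i hi
  obtain ⟨N, hN⟩ : ∃ N, N = S.card := ⟨_, rfl⟩
  obtain ⟨ε, hε0, hε⟩ : ∃ ε : ℝ, 0 < ε ∧ N * (N * ε + ε) + ε < δ := by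
    refine ⟨δ / (N * (N + 1) + 2), by positivity, ?_⟩
    have : (N : ℝ) * (N * (δ / (N * (N + 1) + 2)) + δ / (N * (N + 1) + 2))
        + δ / (N * (N + 1) + 2) = δ - δ / (N * (N + 1) + 2) := by
      field_simp
      ring
    rw [this]
    exact sub_lt_self _ (by positivity)
  have hN1 : (1 : ℝ) ≤ N := by
    rw [hN]; exact_mod_cast hS.card_pos
  have hNε : 0 ≤ N * ε := by positivity
  have hNε' : N * ε + ε ≤ N * (N * ε + ε) := le_mul_of_one_le_left (by positivity) hN1
  have hcard : ∀ k i, (trustSet d η S (x k) i).card ≤ N := fun k i => hN ▸ card_filter_le _ _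
  obtain ⟨m, K, hlow, hwit⟩ : ∃ (m : ℝ) (K : ℕ), (∀ k, K ≤ k → ∀ i ∈ S, m - ε ≤ x k i) ∧
      ∀ k, ∃ i ∈ S, x k i ≤ m := by
    have hbdd : BddAbove (Set.range fun k => S.inf' hS (x k)) := by
      refine ⟨S.sup' hS (x 0), ?_⟩
      rintro _ ⟨k, rfl⟩
      obtain ⟨i, hi⟩ := hS
      exact (inf'_le _ hi).trans (hx.le_sup'_zero hη0 hηd _ k i hi)
    obtain ⟨K, hK⟩ := exists_lt_of_lt_ciSup
      (show (⨆ k, S.inf' hS (x k)) - ε < ⨆ k, S.inf' hS (x k) by linarith)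
    refine ⟨⨆ k, S.inf' hS (x k), K, fun k hk i hi => ?_, fun k => ?_⟩
    · exact hK.le.trans ((hx.monotone_inf' hη0 hηd hS hk).trans (inf'_le _ hi))
    · obtain ⟨i, hi, h⟩ := S.exists_mem_eq_inf' hS (x k)
      exact ⟨i, hi, h ▸ le_ciSup hbdd k⟩
  have hpull : ∀ k, K ≤ k → ∀ i ∈ S, ∀ b, x (k + 1) i ≤ m - ε + b →
      ∀ j ∈ trustSet d η S (x k) i, x k j ≤ m - ε + N * b := by
    intro k hk i hi b hb j hj
    rw [hx k i hi] at hb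
    exact le_of_average_le (hcard k i) (fun j hj => hlow k hk j (mem_trustSet.1 hj).1) hb hj
  have hgap : ∀ k, K ≤ k → ∀ j ∈ S, x k j ≤ m - ε + d → x k j ≤ m + N * ε := by
    intro k hk j hj hjd
    obtain ⟨i, hi, him⟩ := hwit (k + 1)
    have hp := hpull k hk i hi ε (by linarith)
    have hii := hp i (self_mem_trustSet (hη0 i) (hηd i) hi)
    have := hp j (mem_trustSet.2 ⟨hj, by
      linarith [hlow k hk j hj, hδη i hi], by linarith [hlow k hk i hi]⟩)
    linarith
  let C : ℕ → Finset ι := fun k => S.filter fun i => x k i ≤ m + N * ε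
  have hclosed : ∀ k, K ≤ k → ∀ i ∈ C (k + 1), trustSet d η S (x k) i ⊆ C k := by
    intro k hk i hi j hj
    obtain ⟨hi, him⟩ := mem_filter.1 hi
    have hjS := (mem_trustSet.1 hj).1
    refine mem_filter.2 ⟨hjS, hgap k hk j hjS ?_⟩
    have := hpull k hk i hi (N * ε + ε) (by linarith) j hj
    linarith
  have hanti : Antitone fun k => C (K + k) := by
    refine antitone_nat_of_succ_le fun k i hi => hclosed (K + k) (by omega) i hi ?_
    exact self_mem_trustSet (hη0 i) (hηd i) (mem_filter.1 hi).1
  obtain ⟨L, hL⟩ := WellFoundedLT.antitone_chain_condition hanti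
  have hstab : ∀ k, K + L ≤ k → C k = C (K + L) := fun k hk => by
    have := hL (k - K) (by omega)
    simpa [show K + (k - K) = k by omega] using this.symm
  refine ⟨C (K + L), filter_subset _ _, ?_, K + L, fun k hk i hi => ?_⟩
  · obtain ⟨i, hi, him⟩ := hwit (K + L)
    exact ⟨i, mem_filter.2 ⟨hi, by linarith⟩⟩
  have hik := hi
  rw [← hstab k hk] at hik ⊢
  obtain ⟨hiS, him⟩ := mem_filter.1 hik
  refine ⟨(hclosed k (by omega) i (by rwa [hstab (k + 1) (by omega)])).antisymm fun j hj => ?_,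
    fun j hjS hjC => ?_⟩
  · obtain ⟨hjS, hjm⟩ := mem_filter.1 hj
    have h1 := hlow k (by omega) j hjS
    have h2 := hlow k (by omega) i hiS
    have h3 := hδη i hiS
    exact mem_trustSet.2 ⟨hjS, by linarith, by linarith⟩
  · have : ¬ x k j ≤ m + N * ε := fun h => hjC (mem_filter.2 ⟨hjS, h⟩)
    linarith

end IsHKTrajectory

/-- Every trajectory of the asymmetric HK dynamics is eventually constant. -/
lemma IsHKTrajectory.eventually_fixed (hη0 : ∀ i, 0 ≤ η i) (hηd : ∀ i, η i < d)
    (hx : IsHKTrajectory d η S x) : ∃ K, ∀ k, K ≤ k → ∀ i ∈ S, x (k + 1) i = x k i := by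
  classical
  induction S using Finset.strongInduction generalizing x with
  | H S ih =>
    obtain rfl | hS := S.eq_empty_or_nonempty
    · exact ⟨0, by simp⟩
    obtain ⟨C, hCS, hC, K, hK⟩ := hx.exists_isolated_cluster hη0 hηd hS
    have hrest : IsHKTrajectory d η (S \ C) fun k => x (K + k) := by
      intro k j hj
      obtain ⟨hjS, hjC⟩ := mem_sdiff.1 hj
      have : trustSet d η (S \ C) (x (K + k)) j = trustSet d η S (x (K + k)) j := by
        ext i
        simp only [mem_trustSet, mem_sdiff]
        refine ⟨fun h => ⟨h.1.1, h.2⟩, fun h => ⟨⟨h.1, fun hi => ?_⟩, h.2⟩⟩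
        obtain ⟨hiC, hij⟩ := hK (K + k) (by omega) i hi
        refine hjC (hiC ▸ mem_trustSet.2 ⟨hjS, ?_, ?_⟩)
        · linarith [hij j hjS hjC, hηd i]
        · linarith [h.2.1, hη0 j]
      dsimp only
      rw [this]
      exact hx (K + k) j hjS
    obtain ⟨L, hL⟩ := ih (S \ C) (sdiff_ssubset hCS hC) hrest
    refine ⟨K + L + 1, fun k hk i hi => ?_⟩
    by_cases hiC : i ∈ C
    · obtain ⟨k, rfl⟩ : ∃ l, k = l + 1 := ⟨k - 1, by omega⟩
      have hconst : ∀ j ∈ C, x (k + 1) j = x (k + 1) i := fun j hj => by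
        rw [hx k j (hCS hj), hx k i hi, (hK k (by omega) j hj).1, (hK k (by omega) i hiC).1]
      rw [hx (k + 1) i hi, (hK (k + 1) (by omega) i hiC).1]
      exact le_antisymm (average_le hC fun j hj => (hconst j hj).le)
        (le_average hC fun j hj => (hconst j hj).ge)
    · have := hL (k - K) (by omega) i (mem_sdiff.2 ⟨hi, hiC⟩)
      rwa [← add_assoc, show K + (k - K) = k by omega] at this

end HK


/-- **Finite-time termination of the asymmetric heterogeneous HK model.**
Consider the scalar HK model with asymmetric heterogeneous trust sets
`Iᵢ(x) = {j : −d + ηᵢ ≤ xⱼ − xᵢ ≤ d}`, where `ηᵢ ≥ 0` for all `i` and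
`max_i ηᵢ < d` (i.e. `ηᵢ < d` for every `i`).  Then for any initial opinions
the dynamics terminates in finite time. -/
theorem hk_asymmetric_terminates (n : ℕ) (d : ℝ) (hd : 0 < d)
    (η : Fin n → ℝ) (hη_nonneg : ∀ i, 0 ≤ η i) (hη_lt : ∀ i, η i < d)
    (x : ℕ → Fin n → ℝ)
    (hdyn : ∀ k i, x (k + 1) i =
      (∑ j ∈ univ.filter
          (fun j => -d + η i ≤ x k j - x k i ∧ x k j - x k i ≤ d), x k j) /
      ((univ.filter
          (fun j => -d + η i ≤ x k j - x k i ∧ x k j - x k i ≤ d)).card : ℝ)) :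
    ∃ kstar : ℕ, ∀ k, kstar ≤ k → x k = x kstar := by
  have hx : IsHKTrajectory d η univ x := fun k i _ => hdyn k i
  obtain ⟨K, hK⟩ := hx.eventually_fixed hη_nonneg hη_lt
  refine ⟨K, fun k hk => ?_⟩
  induction k, hk using Nat.le_induction with
  | base => rfl
  | succ k hk ih => rw [← ih]; exact funext fun i => hK k hk i (mem_univ i)
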